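/- Let ⟨ξ_E, π_E⟩ : E ⥤ A × B and ⟨ξ_F, π_F⟩ : F ⥤ B × C be two-sided fibrations. Let E ×_B F be the category whose objects are pairs (e, x) with π_E e = ξ_F x and whose morphisms (e,x) → (e',x') are pairs (m : e → e', n : x → x') with π_E m = ξ_F n. Then the span ⟨ξ_E ∘ pr₁, π_F ∘ pr₂⟩ : E ×_B F ⥤ A × C is a two-sided fibration; moreover, an opcartesian lift of u : a → a' at (e,x) is given by (k(u,e), id_x), where k(u,e) is a chosen π_E-vertical ξ_E-opcartesian lift of u at e, and a cartesian lift of w : c' → c at (e,x) is given by (id_e, k'(w,x)), where k'(w,x) is a chosen ξ_F-vertical π_F-cartesian lift of w at x. (Span composition of two-sided fibrations.) -/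

import Mathlib

open CategoryTheory

universe w v₁ u₁ v₂ u₂ v₃ u₃ v₄ u₄ v₅ u₅ v₆ u₆

section BasicDefs

variable {E : Type u₁} [Category.{v₁} E] {B : Type u₂} [Category.{v₂} B]
  {A : Type u₃} [Category.{v₃} A]

/-- `f` is a `π`-opcartesian morphism. -/
def IsOpcartesianMor (π : E ⥤ B) {e e' : E} (f : e ⟶ e') : Prop :=
  ∀ ⦃e'' : E⦄ (g : e ⟶ e'') (w : π.obj e' ⟶ π.obj e''),
    π.map f ≫ w = π.map g → ∃! h : e' ⟶ e'', π.map h = w ∧ f ≫ h = g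

/-- `f` is a `π`-cartesian morphism. -/
def IsCartesianMor (π : E ⥤ B) {e' e : E} (f : e' ⟶ e) : Prop :=
  ∀ ⦃e'' : E⦄ (g : e'' ⟶ e) (w : π.obj e'' ⟶ π.obj e'),
    w ≫ π.map f = π.map g → ∃! h : e'' ⟶ e', π.map h = w ∧ h ≫ f = g

/-- `f` is `π`-vertical, i.e. `π` sends it to an identity. -/
def IsVerticalMor (π : E ⥤ B) {e e' : E} (f : e ⟶ e') : Prop :=
  ∃ h : π.obj e = π.obj e', π.map f = eqToHom h

/-- `π` is a Grothendieck opfibration. -/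
def IsGrothendieckOpfib (π : E ⥤ B) : Prop :=
  ∀ (e : E) ⦃b : B⦄ (u : π.obj e ⟶ b),
    ∃ (e' : E) (f : e ⟶ e') (hb : π.obj e' = b),
      IsOpcartesianMor π f ∧ π.map f ≫ eqToHom hb = u

/-- `π` is a Grothendieck fibration. -/
def IsGrothendieckFib (π : E ⥤ B) : Prop :=
  ∀ (e : E) ⦃b : B⦄ (v : b ⟶ π.obj e),
    ∃ (e' : E) (f : e' ⟶ e) (hb : π.obj e' = b),
      IsCartesianMor π f ∧ eqToHom hb.symm ≫ π.map f = v

/-- `φ` is a cocartesian fibration sliced over the base of `π`. -/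
def IsSlicedCocartFib {F : Type u₄} [Category.{v₄} F] (π : E ⥤ B) (φ : F ⥤ E) : Prop :=
  ∀ (x : F) (e : E) (k : φ.obj x ⟶ e), IsVerticalMor π k →
    ∃ (x' : F) (f : x ⟶ x') (he : φ.obj x' = e),
      IsOpcartesianMor φ f ∧ φ.map f ≫ eqToHom he = k

/-- The span `⟨ξ,π⟩` is cocartesian on the left. -/
def CocartOnLeft (ξ : E ⥤ A) (π : E ⥤ B) : Prop :=
  ∀ (e : E) ⦃a' : A⦄ (u : ξ.obj e ⟶ a'),
    ∃ (e' : E) (f : e ⟶ e') (ha : ξ.obj e' = a'),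
      IsOpcartesianMor ξ f ∧ IsVerticalMor π f ∧ ξ.map f ≫ eqToHom ha = u

/-- The span `⟨ξ,π⟩` is cartesian on the right. -/
def CartOnRight (ξ : E ⥤ A) (π : E ⥤ B) : Prop :=
  ∀ (e : E) ⦃b' : B⦄ (v : b' ⟶ π.obj e),
    ∃ (e' : E) (f : e' ⟶ e) (hb : π.obj e' = b'),
      IsCartesianMor π f ∧ IsVerticalMor ξ f ∧ eqToHom hb.symm ≫ π.map f = v

/-- `f` and `g` lie over the same arrow of the base (up to `eqToHom`). -/
def OverSameArrow (ξ : E ⥤ A) {x y x' y' : E} (f : x ⟶ y) (g : x' ⟶ y') : Prop :=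
  ∃ (p : ξ.obj x = ξ.obj x') (q : ξ.obj y = ξ.obj y'),
    ξ.map f ≫ eqToHom q = eqToHom p ≫ ξ.map g

/-- Cocartesian and cartesian lifts commute: every comparison morphism
`h : u_!(v^* e) ⟶ v^*(u_! e)` is an isomorphism. -/
def LiftsCommute (ξ : E ⥤ A) (π : E ⥤ B) : Prop :=
  ∀ ⦃e e₁ e₂ e₃ e₄ : E⦄ (k : e ⟶ e₁) (k' : e₂ ⟶ e) (f : e₂ ⟶ e₃) (f' : e₄ ⟶ e₁)
    (g : e₃ ⟶ e₁) (h : e₃ ⟶ e₄),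
    IsOpcartesianMor ξ k → IsVerticalMor π k →
    IsCartesianMor π k' → IsVerticalMor ξ k' →
    IsOpcartesianMor ξ f → IsVerticalMor π f → OverSameArrow ξ f k →
    IsCartesianMor π f' → IsVerticalMor ξ f' → OverSameArrow π f' k' →
    IsVerticalMor ξ g → f ≫ g = k' ≫ k →
    IsVerticalMor ξ h → IsVerticalMor π h → h ≫ f' = g →
    IsIso h

/-- Two-sided (cartesian) fibration. -/
def IsTwoSidedFib (ξ : E ⥤ A) (π : E ⥤ B) : Prop :=
  CocartOnLeft ξ π ∧ CartOnRight ξ π ∧ LiftsCommute ξ π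

end BasicDefs

section CartesianMor

variable {E : Type u₁} [Category.{v₁} E] {B : Type u₂} [Category.{v₂} B] {π : E ⥤ B}

theorem IsVerticalMor.isIso_map {e e' : E} {f : e ⟶ e'} (hf : IsVerticalMor π f) :
    IsIso (π.map f) := by
  obtain ⟨p, hp⟩ := hf
  rw [hp]
  infer_instance

theorem IsOpcartesianMor.comp_isIso {x y z : E} {f : x ⟶ y} (hf : IsOpcartesianMor π f)
    (t : y ⟶ z) [IsIso t] : IsOpcartesianMor π (f ≫ t) := by
  intro e'' g w hw
  obtain ⟨h, ⟨h₁, h₂⟩, hu⟩ := hf g (π.map t ≫ w) (by simpa using hw)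
  refine ⟨inv t ≫ h, ⟨by simp [h₁], by simp [h₂]⟩, fun h' ⟨a, b⟩ => ?_⟩
  rw [← hu (t ≫ h') ⟨by simp [a], by simpa using b⟩]
  simp

theorem IsOpcartesianMor.isIso_comp {x y z : E} {f : y ⟶ z} (hf : IsOpcartesianMor π f)
    (t : x ⟶ y) [IsIso t] : IsOpcartesianMor π (t ≫ f) := by
  intro e'' g w hw
  obtain ⟨h, ⟨h₁, h₂⟩, hu⟩ := hf (inv t ≫ g) w (by simp [← hw])
  refine ⟨h, ⟨h₁, by simp [h₂]⟩, fun h' ⟨a, b⟩ => hu h' ⟨a, by simp [← b]⟩⟩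

/-- A morphism between opcartesian morphisms which lies over an isomorphism is invertible. -/
theorem IsOpcartesianMor.isIso_of_comp {x y z : E} {f : x ⟶ y} {t : y ⟶ z}
    (hf : IsOpcartesianMor π f) (hft : IsOpcartesianMor π (f ≫ t)) (ht : IsIso (π.map t)) :
    IsIso t := by
  obtain ⟨s, ⟨h₁, h₂⟩, -⟩ := hft f (inv (π.map t)) (by simp)
  exact ⟨s, (hf f (𝟙 _) (by simp)).unique ⟨by simp [h₁], by simpa using h₂⟩ (by simp),
    (hft (f ≫ t) (𝟙 _) (by simp)).unique
      ⟨by simp [h₁], by simp only [← Category.assoc, h₂]⟩ (by simp)⟩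

theorem IsCartesianMor.comp_isIso {x y z : E} {f : x ⟶ y} (hf : IsCartesianMor π f)
    (t : y ⟶ z) [IsIso t] : IsCartesianMor π (f ≫ t) := by
  intro e'' g w hw
  obtain ⟨h, ⟨h₁, h₂⟩, hu⟩ := hf (g ≫ inv t) w (by simp [← hw])
  refine ⟨h, ⟨h₁, by rw [← Category.assoc, h₂]; simp⟩,
    fun h' ⟨a, b⟩ => hu h' ⟨a, by simp [← b]⟩⟩

theorem IsCartesianMor.isIso_comp {x y z : E} {f : y ⟶ z} (hf : IsCartesianMor π f)
    (t : x ⟶ y) [IsIso t] : IsCartesianMor π (t ≫ f) := by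
  intro e'' g w hw
  obtain ⟨h, ⟨h₁, h₂⟩, hu⟩ := hf g (w ≫ π.map t) (by simpa using hw)
  refine ⟨h ≫ inv t, ⟨by simp [h₁], by simp [h₂]⟩, fun h' ⟨a, b⟩ => ?_⟩
  rw [← hu (h' ≫ t) ⟨by simp [a], by simpa using b⟩]
  simp

/-- A morphism between cartesian morphisms which lies over an isomorphism is invertible. -/
theorem IsCartesianMor.isIso_of_comp {x y z : E} {f : y ⟶ z} {t : x ⟶ y}
    (hf : IsCartesianMor π f) (htf : IsCartesianMor π (t ≫ f)) (ht : IsIso (π.map t)) :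
    IsIso t := by
  obtain ⟨s, ⟨h₁, h₂⟩, -⟩ := htf f (inv (π.map t)) (by simp)
  exact ⟨s, (htf (t ≫ f) (𝟙 _) (by simp)).unique
      ⟨by simp [h₁], by simp only [Category.assoc, h₂]⟩ (by simp),
    (hf f (𝟙 _) (by simp)).unique ⟨by simp [h₁], by simpa using h₂⟩ (by simp)⟩

end CartesianMor

section Statement12

variable {E : Type u₁} [Category.{v₁} E] {F : Type u₂} [Category.{v₂} F]
  {A : Type u₃} [Category.{v₃} A] {B : Type u₄} [Category.{v₄} B]
  {C : Type u₅} [Category.{v₅} C]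

/-- The (strict) fiber product `E ×_B F` of `πE : E ⥤ B` and `ξF : F ⥤ B`. -/
structure TSFiberProd (πE : E ⥤ B) (ξF : F ⥤ B) : Type max u₁ u₂ where
  e : E
  x : F
  h : πE.obj e = ξF.obj x

/-- Morphisms of the fiber product. -/
structure TSFiberProdHom {πE : E ⥤ B} {ξF : F ⥤ B} (X Y : TSFiberProd πE ξF) where
  m : X.e ⟶ Y.e
  n : X.x ⟶ Y.x
  w : πE.map m ≫ eqToHom Y.h = eqToHom X.h ≫ ξF.map n

variable {πE : E ⥤ B} {ξF : F ⥤ B}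

theorem TSFiberProdHom.ext' {X Y : TSFiberProd πE ξF} {f g : TSFiberProdHom X Y}
    (h1 : f.m = g.m) (h2 : f.n = g.n) : f = g := by
  cases f; cases g; cases h1; cases h2; rfl

instance : Category (TSFiberProd πE ξF) where
  Hom := TSFiberProdHom
  id X := ⟨𝟙 X.e, 𝟙 X.x, by simp⟩
  comp f g := ⟨f.m ≫ g.m, f.n ≫ g.n, by
    rw [Functor.map_comp, Functor.map_comp, Category.assoc, g.w, ← Category.assoc,
      f.w, Category.assoc]⟩
  id_comp f := TSFiberProdHom.ext' (by simp) (by simp)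
  comp_id f := TSFiberProdHom.ext' (by simp) (by simp)
  assoc f g h := TSFiberProdHom.ext' (by simp) (by simp)

/-- First projection of the fiber product. -/
def tsfpFst (πE : E ⥤ B) (ξF : F ⥤ B) : TSFiberProd πE ξF ⥤ E where
  obj X := X.e
  map f := f.m
  map_id _ := rfl
  map_comp _ _ := rfl

/-- Second projection of the fiber product. -/
def tsfpSnd (πE : E ⥤ B) (ξF : F ⥤ B) : TSFiberProd πE ξF ⥤ F where
  obj X := X.x
  map f := f.n
  map_id _ := rfl
  map_comp _ _ := rfl

theorem TSFiberProdHom.isIso {X Y : TSFiberProd πE ξF} (f : X ⟶ Y)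
    (hm : IsIso ((tsfpFst πE ξF).map f)) (hn : IsIso ((tsfpSnd πE ξF).map f)) : IsIso f := by
  have : IsIso f.m := hm
  have : IsIso f.n := hn
  refine ⟨⟨inv f.m, inv f.n, ?_⟩, TSFiberProdHom.ext' (IsIso.hom_inv_id f.m)
    (IsIso.hom_inv_id f.n), TSFiberProdHom.ext' (IsIso.inv_hom_id f.m) (IsIso.inv_hom_id f.n)⟩
  rw [Functor.map_inv, Functor.map_inv, IsIso.inv_comp_eq, ← Category.assoc, IsIso.eq_comp_inv]
  exact f.w.symm

/-- The morphism `(f, 𝟙)` of the fiber product given by a vertical morphism `f`. -/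
def TSFiberProd.pushHom (X : TSFiberProd πE ξF) {e' : E} (f : X.e ⟶ e')
    (hv : IsVerticalMor πE f) (he : πE.obj e' = ξF.obj X.x) :
    X ⟶ (⟨e', X.x, he⟩ : TSFiberProd πE ξF) :=
  ⟨f, 𝟙 X.x, by obtain ⟨p, hp⟩ := hv; rw [hp]; simp⟩

/-- The morphism `(𝟙, f)` of the fiber product given by a vertical morphism `f`. -/
def TSFiberProd.pullHom (X : TSFiberProd πE ξF) {x' : F} (f : x' ⟶ X.x)
    (hv : IsVerticalMor ξF f) (he : πE.obj X.e = ξF.obj x') :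
    (⟨X.e, x', he⟩ : TSFiberProd πE ξF) ⟶ X :=
  ⟨𝟙 X.e, f, by obtain ⟨p, hp⟩ := hv; rw [hp]; simp⟩

theorem TSFiberProd.isOpcartesianMor_pushHom {ξE : E ⥤ A} (X : TSFiberProd πE ξF) {e' : E}
    {f : X.e ⟶ e'} (hf : IsOpcartesianMor ξE f) (hv : IsVerticalMor πE f)
    (he : πE.obj e' = ξF.obj X.x) :
    IsOpcartesianMor (tsfpFst πE ξF ⋙ ξE) (X.pushHom f hv he) := by
  intro Y g w hw
  obtain ⟨h, ⟨h₁, h₂⟩, hu⟩ := hf g.m w hw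
  refine ⟨⟨h, g.n, ?_⟩, ⟨h₁, TSFiberProdHom.ext' h₂ (Category.id_comp g.n)⟩, ?_⟩
  · obtain ⟨p, hp⟩ := hv
    have hg := g.w
    rw [← h₂, Functor.map_comp, hp, Category.assoc] at hg
    rw [← cancel_epi (eqToHom p), hg, ← Category.assoc, eqToHom_trans]
  · rintro h' ⟨a, b⟩
    refine TSFiberProdHom.ext' (hu h'.m ⟨a, congrArg TSFiberProdHom.m b⟩) ?_
    exact (Category.id_comp h'.n).symm.trans (congrArg TSFiberProdHom.n b)

theorem TSFiberProd.isCartesianMor_pullHom {πF : F ⥤ C} (X : TSFiberProd πE ξF) {x' : F}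
    {f : x' ⟶ X.x} (hf : IsCartesianMor πF f) (hv : IsVerticalMor ξF f)
    (he : πE.obj X.e = ξF.obj x') :
    IsCartesianMor (tsfpSnd πE ξF ⋙ πF) (X.pullHom f hv he) := by
  intro Y g w hw
  obtain ⟨h, ⟨h₁, h₂⟩, hu⟩ := hf g.n w hw
  refine ⟨⟨g.m, h, ?_⟩, ⟨h₁, TSFiberProdHom.ext' (Category.comp_id g.m) h₂⟩, ?_⟩
  · obtain ⟨p, hp⟩ := hv
    have hg := g.w
    rw [← h₂, Functor.map_comp, hp, ← Category.assoc] at hg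
    rw [← cancel_mono (eqToHom p), ← hg, Category.assoc, eqToHom_trans]
  · rintro h' ⟨a, b⟩
    refine TSFiberProdHom.ext' ?_ (hu h'.n ⟨a, congrArg TSFiberProdHom.n b⟩)
    exact (Category.comp_id h'.m).symm.trans (congrArg TSFiberProdHom.m b)

/-- Opcartesian morphisms of the fiber product have an opcartesian first component and an
invertible second component. -/
theorem IsOpcartesianMor.tsfp_components {ξE : E ⥤ A} (hE : CocartOnLeft ξE πE)
    {X Y : TSFiberProd πE ξF} {k : X ⟶ Y} (hk : IsOpcartesianMor (tsfpFst πE ξF ⋙ ξE) k) :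
    IsOpcartesianMor ξE ((tsfpFst πE ξF).map k) ∧ IsIso ((tsfpSnd πE ξF).map k) := by
  obtain ⟨e', f, ha, hf, hv, hfu⟩ := hE X.e (ξE.map k.m)
  have he : πE.obj e' = ξF.obj X.x := hv.choose.symm.trans X.h
  have hc := X.isOpcartesianMor_pushHom hf hv he
  obtain ⟨t, ⟨ht, rfl⟩, -⟩ := hc k (eqToHom ha) hfu
  have : IsIso t := hc.isIso_of_comp hk (by rw [ht]; exact inferInstanceAs (IsIso (eqToHom ha)))
  rw [Functor.map_comp, Functor.map_comp]
  have : IsIso ((tsfpSnd πE ξF).map (X.pushHom f hv he)) := inferInstanceAs (IsIso (𝟙 X.x))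
  exact ⟨IsOpcartesianMor.comp_isIso (f := (tsfpFst πE ξF).map (X.pushHom f hv he)) hf _,
    inferInstance⟩

/-- Cartesian morphisms of the fiber product have an invertible first component and a
cartesian second component. -/
theorem IsCartesianMor.tsfp_components {πF : F ⥤ C} (hF : CartOnRight ξF πF)
    {X Y : TSFiberProd πE ξF} {k : Y ⟶ X} (hk : IsCartesianMor (tsfpSnd πE ξF ⋙ πF) k) :
    IsIso ((tsfpFst πE ξF).map k) ∧ IsCartesianMor πF ((tsfpSnd πE ξF).map k) := by
  obtain ⟨x', f, hb, hf, hv, hfu⟩ := hF X.x (πF.map k.n)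
  have he : πE.obj X.e = ξF.obj x' := X.h.trans hv.choose.symm
  have hc := X.isCartesianMor_pullHom hf hv he
  obtain ⟨t, ⟨ht, rfl⟩, -⟩ := hc k (eqToHom hb.symm) hfu
  have : IsIso t := hc.isIso_of_comp hk (by rw [ht]; exact inferInstanceAs (IsIso (eqToHom hb.symm)))
  rw [Functor.map_comp, Functor.map_comp]
  have : IsIso ((tsfpFst πE ξF).map (X.pullHom f hv he)) := inferInstanceAs (IsIso (𝟙 X.e))
  exact ⟨inferInstance,
    IsCartesianMor.isIso_comp (f := (tsfpSnd πE ξF).map (X.pullHom f hv he)) hf _⟩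

theorem CocartOnLeft.spanComp {ξE : E ⥤ A} (hE : CocartOnLeft ξE πE) (πF : F ⥤ C) :
    CocartOnLeft (tsfpFst πE ξF ⋙ ξE) (tsfpSnd πE ξF ⋙ πF) := by
  intro X a' u
  obtain ⟨e', f, ha, hf, hv, hfu⟩ := hE X.e u
  have he : πE.obj e' = ξF.obj X.x := hv.choose.symm.trans X.h
  exact ⟨_, X.pushHom f hv he, ha, X.isOpcartesianMor_pushHom hf hv he,
    ⟨rfl, πF.map_id X.x⟩, hfu⟩

theorem CartOnRight.spanComp {πF : F ⥤ C} (hF : CartOnRight ξF πF) (ξE : E ⥤ A) :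
    CartOnRight (tsfpFst πE ξF ⋙ ξE) (tsfpSnd πE ξF ⋙ πF) := by
  intro X c' v
  obtain ⟨x', f, hb, hf, hv, hfu⟩ := hF X.x v
  have he : πE.obj X.e = ξF.obj x' := X.h.trans hv.choose.symm
  exact ⟨_, X.pullHom f hv he, hb, X.isCartesianMor_pullHom hf hv he,
    ⟨rfl, ξE.map_id X.e⟩, hfu⟩

/-- In a composite span the left and right lifts act on different components, so they
commute even if this is not assumed of the two factors. -/
theorem LiftsCommute.spanComp {ξE : E ⥤ A} {πF : F ⥤ C} (hE : CocartOnLeft ξE πE)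
    (hF : CartOnRight ξF πF) :
    LiftsCommute (tsfpFst πE ξF ⋙ ξE) (tsfpSnd πE ξF ⋙ πF) := by
  rintro X X₁ X₂ X₃ X₄ k k' f f' g h hk _ hk' _ hf hfv _ hf' hfv' _ _ hfg hhv hhv' rfl
  obtain ⟨hkm, hkn⟩ := hk.tsfp_components hE
  obtain ⟨hfm, hfn⟩ := hf.tsfp_components hE
  obtain ⟨hkm', hkn'⟩ := hk'.tsfp_components hF
  obtain ⟨hfm', hfn'⟩ := hf'.tsfp_components hF
  have hfst := congrArg (tsfpFst πE ξF).map hfg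
  have hsnd := congrArg (tsfpSnd πE ξF).map hfg
  simp only [Functor.map_comp] at hfst hsnd
  have h₁ := hhv.isIso_map
  have h₂ := hhv'.isIso_map
  have h₃ := hfv.isIso_map
  have h₄ := hfv'.isIso_map
  simp only [Functor.comp_map] at h₁ h₂ h₃ h₄
  apply TSFiberProdHom.isIso
  · have := hfm.isIso_of_comp (hfst ▸ hkm.isIso_comp _)
      (by rw [Functor.map_comp]; infer_instance)
    exact IsIso.of_isIso_comp_right _ ((tsfpFst πE ξF).map f')
  · rw [← Category.assoc] at hsnd
    have := hfn'.isIso_of_comp (hsnd ▸ hkn'.comp_isIso _)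
      (by rw [Functor.map_comp]; infer_instance)
    exact IsIso.of_isIso_comp_left ((tsfpSnd πE ξF).map f) _

/-- **Span composition of two-sided fibrations.** Given two-sided fibrations
`⟨ξE,πE⟩ : E ⥤ A × B` and `⟨ξF,πF⟩ : F ⥤ B × C`, the span
`⟨ξE ∘ pr₁, πF ∘ pr₂⟩ : E ×_B F ⥤ A × C` is a two-sided fibration; an opcartesian
lift of `u` at `(e,x)` is given by `(k(u,e), 𝟙 x)` and a cartesian lift of `w` at
`(e,x)` by `(𝟙 e, k'(w,x))`. -/
theorem isTwoSidedFib_spanComp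
    (ξE : E ⥤ A) (πF : F ⥤ C)
    (h₁ : IsTwoSidedFib ξE πE) (h₂ : IsTwoSidedFib ξF πF) :
    IsTwoSidedFib (tsfpFst πE ξF ⋙ ξE) (tsfpSnd πE ξF ⋙ πF) ∧
    (∀ (X : TSFiberProd πE ξF) ⦃e' : E⦄ (f : X.e ⟶ e'),
      IsOpcartesianMor ξE f → ∀ (hv : IsVerticalMor πE f) (he : πE.obj e' = ξF.obj X.x),
      IsOpcartesianMor (tsfpFst πE ξF ⋙ ξE)
        (show X ⟶ ⟨e', X.x, he⟩ from
          ⟨f, 𝟙 X.x, by obtain ⟨p, hp⟩ := hv; rw [hp]; simp⟩)) ∧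
    (∀ (X : TSFiberProd πE ξF) ⦃x' : F⦄ (f : x' ⟶ X.x),
      IsCartesianMor πF f → ∀ (hv : IsVerticalMor ξF f) (he : πE.obj X.e = ξF.obj x'),
      IsCartesianMor (tsfpSnd πE ξF ⋙ πF)
        (show (⟨X.e, x', he⟩ : TSFiberProd πE ξF) ⟶ X from
          ⟨𝟙 X.e, f, by obtain ⟨p, hp⟩ := hv; rw [hp]; simp⟩)) := by
  obtain ⟨hE, -, -⟩ := h₁
  obtain ⟨-, hF, -⟩ := h₂
  refine ⟨⟨hE.spanComp πF, hF.spanComp ξE, LiftsCommute.spanComp hE hF⟩, ?_, ?_⟩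
  · exact fun X _ _ hf hv he => X.isOpcartesianMor_pushHom hf hv he
  · exact fun X _ _ hf hv he => X.isCartesianMor_pullHom hf hv he

end Statement12
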